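/- Let n ≥ 2 and m ≥ 1, let A be an m × m matrix over Z_n, and suppose n has prime factorization p_1^{α_1} p_2^{α_2} ⋯ p_ω^{α_ω}. Then the system height of ((Z_n)^m, x ↦ A x) equals the maximum of the system heights of the subsystems ((Z_{p_k^{α_k}})^m, x ↦ (A mod p_k^{α_k}) x) for k = 1, …, ω, where A mod p_k^{α_k} is the matrix obtained by reducing each entry of A modulo p_k^{α_k}. -/

import Mathlib

/-- An element `x` is a cycle vertex of the system `(M, f)` if `f^[l] x = x`
for some positive integer `l`. -/
def IsCycleVertex {M : Type*} (f : M → M) (x : M) : Prop :=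
  ∃ l : ℕ, 0 < l ∧ f^[l] x = x

/-- The height of an element `x`: the least `k` such that `f^[k] x` is a cycle vertex. -/
noncomputable def height {M : Type*} (f : M → M) (x : M) : ℕ :=
  sInf {k : ℕ | IsCycleVertex f (f^[k] x)}

/-- The system height: the maximum height over all elements. -/
noncomputable def systemHeight {M : Type*} (f : M → M) : ℕ :=
  sSup (Set.range (height f))

open Function

theorem IsCycleVertex.iterate {M : Type*} {f : M → M} {x : M} (h : IsCycleVertex f x) (k : ℕ) :
    IsCycleVertex f (f^[k] x) := by
  obtain ⟨l, hl, hx⟩ := h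
  exact ⟨l, hl, IsPeriodicPt.apply_iterate hx k⟩

theorem IsCycleVertex.map {M N : Type*} {f : M → M} {g : N → N} {π : M → N}
    (hπ : Semiconj π f g) {x : M} (h : IsCycleVertex f x) : IsCycleVertex g (π x) := by
  obtain ⟨l, hl, hx⟩ := h
  exact ⟨l, hl, IsPeriodicPt.map hx hπ⟩

theorem exists_isCycleVertex_iterate {M : Type*} [Finite M] (f : M → M) (x : M) :
    ∃ k, IsCycleVertex f (f^[k] x) := by
  obtain ⟨a, b, hab, h⟩ := Finite.exists_ne_map_eq_of_infinite fun k : ℕ => f^[k] x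
  wlog hlt : a < b generalizing a b
  · exact this b a hab.symm h.symm (by omega)
  refine ⟨a, b - a, by omega, ?_⟩
  rw [← iterate_add_apply, Nat.sub_add_cancel hlt.le]
  exact h.symm

theorem height_le_iff {M : Type*} [Finite M] (f : M → M) (x : M) (K : ℕ) :
    height f x ≤ K ↔ IsCycleVertex f (f^[K] x) := by
  refine ⟨fun h => ?_, fun h => Nat.sInf_le h⟩
  have hmem : IsCycleVertex f (f^[height f x] x) := Nat.sInf_mem (exists_isCycleVertex_iterate f x)
  have := hmem.iterate (K - height f x)
  rwa [← iterate_add_apply, Nat.sub_add_cancel h] at this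

theorem systemHeight_le_iff {M : Type*} [Finite M] [Nonempty M] (f : M → M) (K : ℕ) :
    systemHeight f ≤ K ↔ ∀ x, IsCycleVertex f (f^[K] x) := by
  simp_rw [← height_le_iff]
  exact ciSup_le_iff (Set.finite_range (height f)).bddAbove

/-- A point is a cycle vertex as soon as its images under a finite jointly injective family of
semiconjugacies are. -/
theorem IsCycleVertex.of_forall_map {ι M : Type*} [Fintype ι] {N : ι → Type*} {f : M → M}
    {g : ∀ i, N i → N i} {π : ∀ i, M → N i} (hπ : ∀ i, Semiconj (π i) f (g i))
    (hinj : ∀ x y, (∀ i, π i x = π i y) → x = y) {x : M}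
    (h : ∀ i, IsCycleVertex (g i) (π i x)) : IsCycleVertex f x := by
  choose l hl hx using h
  refine ⟨∏ i, l i, Finset.prod_pos fun i _ => hl i, hinj _ _ fun i => ?_⟩
  rw [((hπ i).iterate_right _).eq]
  exact IsPeriodicPt.trans_dvd (hx i) (Finset.dvd_prod_of_mem l (Finset.mem_univ i))

theorem systemHeight_eq_sup_of_semiconj {ι M : Type*} [Fintype ι] {N : ι → Type*} [Finite M]
    [Nonempty M] [∀ i, Finite (N i)] {f : M → M} {g : ∀ i, N i → N i} {π : ∀ i, M → N i}
    (hπ : ∀ i, Semiconj (π i) f (g i)) (hsurj : ∀ i, Surjective (π i))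
    (hinj : ∀ x y, (∀ i, π i x = π i y) → x = y) :
    systemHeight f = Finset.univ.sup fun i => systemHeight (g i) := by
  have (i : ι) : Nonempty (N i) := Nonempty.map (π i) inferInstance
  refine eq_of_forall_ge_iff fun K => ?_
  simp only [Finset.sup_le_iff, Finset.mem_univ, true_imp_iff, systemHeight_le_iff]
  constructor
  · intro h i y
    obtain ⟨x, rfl⟩ := hsurj i y
    rw [← ((hπ i).iterate_right K).eq]
    exact (h x).map (hπ i)
  · intro h x
    refine IsCycleVertex.of_forall_map hπ hinj fun i => ?_
    rw [((hπ i).iterate_right K).eq]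
    exact h i _

theorem ZMod.eq_of_forall_castHom_eq {ι : Type*} [Fintype ι] {n : ℕ} {q : ι → ℕ}
    (hq : Pairwise (Nat.Coprime on q)) (hn : n = ∏ i, q i) (hdvd : ∀ i, q i ∣ n) {a b : ZMod n}
    (h : ∀ i, ZMod.castHom (hdvd i) (ZMod (q i)) a = ZMod.castHom (hdvd i) (ZMod (q i)) b) :
    a = b := by
  obtain ⟨z, hz⟩ := ZMod.intCast_surjective (a - b)
  rw [← sub_eq_zero, ← hz, ZMod.intCast_zmod_eq_zero_iff_dvd, hn, Nat.cast_prod]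
  refine Fintype.prod_dvd_of_coprime (fun i j hij => (hq hij).isCoprime) fun i => ?_
  rw [← ZMod.intCast_zmod_eq_zero_iff_dvd, ← map_intCast (ZMod.castHom (hdvd i) (ZMod (q i))), hz,
    map_sub, h i, sub_self]

/-- If `n = ∏ pₖ^αₖ` is the prime factorization of `n`, then the system height of
`((ZMod n)^m, x ↦ A x)` equals the largest of the system heights of the subsystems
`((ZMod (pₖ^αₖ))^m, x ↦ (A mod pₖ^αₖ) x)` from the primary decomposition. -/
theorem systemHeight_eq_sup_primary_subsystems
    (n m ω : ℕ) (hn : 2 ≤ n) (hm : 1 ≤ m)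
    (p α : Fin ω → ℕ) (hp : ∀ i, (p i).Prime) (hpinj : Function.Injective p)
    (hα : ∀ i, 1 ≤ α i) (hfac : n = ∏ i, p i ^ α i)
    (A : Matrix (Fin m) (Fin m) (ZMod n)) :
    systemHeight A.mulVec =
      Finset.univ.sup (fun k =>
        systemHeight ((A.map (ZMod.cast : ZMod n → ZMod (p k ^ α k))).mulVec)) := by
  have : NeZero n := ⟨by omega⟩
  have (k : Fin ω) : NeZero (p k ^ α k) := ⟨pow_ne_zero _ (hp k).ne_zero⟩
  have hdvd (k : Fin ω) : p k ^ α k ∣ n :=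
    hfac ▸ Finset.dvd_prod_of_mem (fun i => p i ^ α i) (Finset.mem_univ k)
  have hcop : Pairwise (Nat.Coprime on fun k => p k ^ α k) := fun i j hij =>
    Nat.Coprime.pow _ _ ((Nat.coprime_primes (hp i) (hp j)).2 (hpinj.ne hij))
  refine systemHeight_eq_sup_of_semiconj
    (π := fun k x => ZMod.castHom (hdvd k) (ZMod (p k ^ α k)) ∘ x) ?_ ?_ ?_
  · intro k x
    ext i
    exact RingHom.map_mulVec (ZMod.castHom (hdvd k) (ZMod (p k ^ α k))) A x i
  · exact fun k => (ZMod.castHom_surjective (hdvd k)).comp_left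
  · intro x y h
    ext i
    exact ZMod.eq_of_forall_castHom_eq hcop hfac hdvd fun k => congrFun (h k) i
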